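/- Fix γ ∈ (0,1], d ≥ 1, and a probability distribution P on S^{d−1} × {−1,1}. Then: (i) for every w in the closed unit ball B_d of ℝ^d, err_P(w) ≤ (8/9)·ℓ_γ(w;P) ≤ ℓ_γ(w;P); and (ii) if there exists a unit vector w* ∈ S^{d−1} with ⟨w*, x⟩ y ≥ γ for P-almost every (x,y), then inf_{w ∈ B_d} ℓ_γ(w;P) ≤ 1/8. Consequently, under the assumption of (ii), if ŵ is any random vector taking values in B_d with E[ℓ_γ(ŵ;P)] ≤ inf_{w ∈ B_d} ℓ_γ(w;P) + 1/8, then E[err_P(ŵ)] ≤ 1/4. -/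

import Mathlib

open MeasureTheory RealInnerProductSpace

/-- The piecewise part `ψ` of the loss: `ψ(t) = 1 - 2t/γ` for `t ≤ 0`,
`ψ(t) = (t-γ)²/γ²` for `0 ≤ t ≤ γ`, and `ψ(t) = 0` for `t ≥ γ`. -/
noncomputable def psiLoss (γ t : ℝ) : ℝ :=
  if t ≤ 0 then 1 - 2 * t / γ else if t ≤ γ then (t - γ) ^ 2 / γ ^ 2 else 0

/-- The loss `φ_γ(t) = (1-t)²/8 + ψ(t)`. -/
noncomputable def phiLoss (γ t : ℝ) : ℝ := (1 - t) ^ 2 / 8 + psiLoss γ t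

/-- The population loss `ℓ_γ(w;P) = E_{(x,y)∼P}[φ_γ(⟨w,x⟩y)]`. -/
noncomputable def popLoss {d : ℕ} (γ : ℝ) (P : Measure (EuclideanSpace ℝ (Fin d) × ℝ))
    (w : EuclideanSpace ℝ (Fin d)) : ℝ :=
  ∫ p, phiLoss γ (⟪w, p.1⟫ * p.2) ∂P

/-- The classification error `err_P(w) = Pr_{(x,y)∼P}[⟨w,x⟩y ≤ 0]`. -/
noncomputable def clsErr {d : ℕ} (P : Measure (EuclideanSpace ℝ (Fin d) × ℝ))
    (w : EuclideanSpace ℝ (Fin d)) : ℝ :=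
  (P {p | ⟪w, p.1⟫ * p.2 ≤ 0}).toReal

lemma psiLoss_nonneg {γ : ℝ} (hγ : 0 < γ) (t : ℝ) : 0 ≤ psiLoss γ t := by
  unfold psiLoss
  split_ifs with h1 h2
  · have : 2 * t / γ ≤ 0 := div_nonpos_of_nonpos_of_nonneg (by linarith) hγ.le
    linarith
  · positivity
  · exact le_rfl

lemma psiLoss_le {γ : ℝ} (hγ : 0 < γ) {t : ℝ} (ht : -1 ≤ t) : psiLoss γ t ≤ 1 + 2 / γ := by
  have h0 : 0 < 2 / γ := by positivity
  unfold psiLoss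
  split_ifs with h1 h2
  · have : -(2 * t / γ) ≤ 2 / γ := by
      rw [← neg_div]
      gcongr
      linarith
    linarith
  · have : (t - γ) ^ 2 / γ ^ 2 ≤ 1 := by
      rw [div_le_one (by positivity)]
      nlinarith
    linarith
  · linarith

lemma phiLoss_nonneg {γ : ℝ} (hγ : 0 < γ) (t : ℝ) : 0 ≤ phiLoss γ t :=
  add_nonneg (by positivity) (psiLoss_nonneg hγ t)

lemma phiLoss_le {γ : ℝ} (hγ : 0 < γ) {t : ℝ} (ht : |t| ≤ 1) :
    phiLoss γ t ≤ 3 / 2 + 2 / γ := by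
  obtain ⟨h1, h2⟩ := abs_le.1 ht
  have := psiLoss_le hγ h1
  unfold phiLoss
  nlinarith

lemma nine_eighths_le_phiLoss {γ : ℝ} (hγ : 0 < γ) {t : ℝ} (ht : t ≤ 0) :
    9 / 8 ≤ phiLoss γ t := by
  have : 2 * t / γ ≤ 0 := div_nonpos_of_nonpos_of_nonneg (by linarith) hγ.le
  rw [phiLoss, psiLoss, if_pos ht]
  nlinarith

lemma phiLoss_le_of_margin {γ : ℝ} (hγ : 0 < γ) {t : ℝ} (ht : γ ≤ t) (ht1 : t ≤ 1) :
    phiLoss γ t ≤ 1 / 8 := by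
  have h : psiLoss γ t = 0 := by
    rw [psiLoss, if_neg (by linarith)]
    split_ifs with h2
    · simp [le_antisymm h2 ht]
    · rfl
  rw [phiLoss, h]
  nlinarith

lemma measurable_phiLoss (γ : ℝ) : Measurable (phiLoss γ) := by
  unfold phiLoss psiLoss
  refine Measurable.add (by fun_prop) ?_
  refine Measurable.ite measurableSet_Iic (by fun_prop) ?_
  exact Measurable.ite measurableSet_Iic (by fun_prop) measurable_const

section PopLoss

variable {d : ℕ} {γ : ℝ} {P : Measure (EuclideanSpace ℝ (Fin d) × ℝ)}

lemma ae_abs_margin_le_one [IsProbabilityMeasure P]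
    (hsupp : P {p | ‖p.1‖ = 1 ∧ (p.2 = 1 ∨ p.2 = -1)} = 1)
    {w : EuclideanSpace ℝ (Fin d)} (hw : ‖w‖ ≤ 1) : ∀ᵐ p ∂P, |⟪w, p.1⟫ * p.2| ≤ 1 := by
  have hm : MeasurableSet {p : EuclideanSpace ℝ (Fin d) × ℝ |
      ‖p.1‖ = 1 ∧ (p.2 = 1 ∨ p.2 = -1)} :=
    ((isClosed_eq (by fun_prop) (by fun_prop)).inter
      ((isClosed_eq (by fun_prop) (by fun_prop)).union
        (isClosed_eq (by fun_prop) (by fun_prop)))).measurableSet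
  filter_upwards [(mem_ae_iff_prob_eq_one hm).2 hsupp] with p hp
  have h2 : |p.2| = 1 := by
    rcases hp.2 with h | h <;> simp [h]
  rw [abs_mul, h2, mul_one]
  calc |⟪w, p.1⟫| ≤ ‖w‖ * ‖p.1‖ := abs_real_inner_le_norm w p.1
    _ ≤ 1 := by rw [hp.1, mul_one]; exact hw

lemma measurable_phiLoss_margin (γ : ℝ) (w : EuclideanSpace ℝ (Fin d)) :
    Measurable fun p : EuclideanSpace ℝ (Fin d) × ℝ => phiLoss γ (⟪w, p.1⟫ * p.2) :=
  (measurable_phiLoss γ).comp (by fun_prop)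

lemma integrable_phiLoss_margin [IsProbabilityMeasure P] (hγ : 0 < γ)
    (hsupp : P {p | ‖p.1‖ = 1 ∧ (p.2 = 1 ∨ p.2 = -1)} = 1)
    {w : EuclideanSpace ℝ (Fin d)} (hw : ‖w‖ ≤ 1) :
    Integrable (fun p => phiLoss γ (⟪w, p.1⟫ * p.2)) P := by
  refine Integrable.of_bound (measurable_phiLoss_margin γ w).aestronglyMeasurable
    (3 / 2 + 2 / γ) ?_
  filter_upwards [ae_abs_margin_le_one hsupp hw] with p hp
  rw [Real.norm_of_nonneg (phiLoss_nonneg hγ _)]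
  exact phiLoss_le hγ hp

lemma popLoss_nonneg (hγ : 0 < γ) (w : EuclideanSpace ℝ (Fin d)) : 0 ≤ popLoss γ P w :=
  integral_nonneg fun _ => phiLoss_nonneg hγ _

lemma popLoss_le_of_ae_le [IsProbabilityMeasure P] (hγ : 0 < γ) {w : EuclideanSpace ℝ (Fin d)}
    {c : ℝ} (h : ∀ᵐ p ∂P, phiLoss γ (⟪w, p.1⟫ * p.2) ≤ c) : popLoss γ P w ≤ c := by
  have := integral_mono_of_nonneg (μ := P) (.of_forall fun _ => phiLoss_nonneg hγ _)
    (integrable_const c) h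
  simpa [popLoss] using this

lemma stronglyMeasurable_popLoss [IsProbabilityMeasure P] : StronglyMeasurable (popLoss γ P) := by
  have h : Measurable fun q : EuclideanSpace ℝ (Fin d) × (EuclideanSpace ℝ (Fin d) × ℝ) =>
      phiLoss γ (⟪q.1, q.2.1⟫ * q.2.2) := (measurable_phiLoss γ).comp (by fun_prop)
  exact h.stronglyMeasurable.integral_prod_right

lemma clsErr_le_popLoss [IsProbabilityMeasure P] (hγ : 0 < γ)
    (hsupp : P {p | ‖p.1‖ = 1 ∧ (p.2 = 1 ∨ p.2 = -1)} = 1)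
    {w : EuclideanSpace ℝ (Fin d)} (hw : ‖w‖ ≤ 1) : clsErr P w ≤ 8 / 9 * popLoss γ P w := by
  have hmarkov := mul_meas_ge_le_integral_of_nonneg (μ := P)
    (.of_forall fun _ => phiLoss_nonneg hγ _) (integrable_phiLoss_margin hγ hsupp hw) (9 / 8)
  have hmono : clsErr P w ≤ P.real {p | 9 / 8 ≤ phiLoss γ (⟪w, p.1⟫ * p.2)} :=
    measureReal_mono fun p hp => nine_eighths_le_phiLoss hγ hp
  change _ ≤ popLoss γ P w at hmarkov
  linarith

end PopLoss

/-- For a probability distribution `P` on `S^{d-1} × {-1,1}`: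
(i) for every `w ∈ B_d`, `err_P(w) ≤ (8/9)·ℓ_γ(w;P) ≤ ℓ_γ(w;P)`;
(ii) if some unit vector classifies with margin `γ` `P`-a.s., then
`inf_{w ∈ B_d} ℓ_γ(w;P) ≤ 1/8`, and consequently any random `ŵ ∈ B_d` with
`E[ℓ_γ(ŵ;P)] ≤ inf_{w ∈ B_d} ℓ_γ(w;P) + 1/8` satisfies `E[err_P(ŵ)] ≤ 1/4`. -/
theorem classification_from_convex_loss (γ : ℝ) (hγ0 : 0 < γ) (hγ1 : γ ≤ 1)
    (d : ℕ) (hd : 1 ≤ d) (P : Measure (EuclideanSpace ℝ (Fin d) × ℝ))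
    [IsProbabilityMeasure P]
    (hsupp : P {p | ‖p.1‖ = 1 ∧ (p.2 = 1 ∨ p.2 = -1)} = 1) :
    (∀ w : EuclideanSpace ℝ (Fin d), ‖w‖ ≤ 1 →
      clsErr P w ≤ 8 / 9 * popLoss γ P w ∧ 8 / 9 * popLoss γ P w ≤ popLoss γ P w) ∧
    ((∃ w₀ : EuclideanSpace ℝ (Fin d), ‖w₀‖ = 1 ∧ P {p | γ ≤ ⟪w₀, p.1⟫ * p.2} = 1) →
      sInf {v : ℝ | ∃ w : EuclideanSpace ℝ (Fin d), ‖w‖ ≤ 1 ∧ v = popLoss γ P w} ≤ 1 / 8 ∧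
      ∀ W : Measure (EuclideanSpace ℝ (Fin d)), IsProbabilityMeasure W →
        W {w | ‖w‖ ≤ 1} = 1 →
        (∫ w, popLoss γ P w ∂W ≤
          sInf {v : ℝ | ∃ w : EuclideanSpace ℝ (Fin d), ‖w‖ ≤ 1 ∧ v = popLoss γ P w} +
            1 / 8) →
        ∫ w, clsErr P w ∂W ≤ 1 / 4) := by
  refine ⟨fun w hw => ⟨clsErr_le_popLoss hγ0 hsupp hw, ?_⟩, ?_⟩
  · have := popLoss_nonneg (P := P) hγ0 w
    linarith
  rintro ⟨w₀, hw₀, hmargin⟩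
  have hInf : sInf {v : ℝ | ∃ w : EuclideanSpace ℝ (Fin d), ‖w‖ ≤ 1 ∧ v = popLoss γ P w} ≤
      1 / 8 := by
    have hbdd : BddBelow {v : ℝ | ∃ w : EuclideanSpace ℝ (Fin d), ‖w‖ ≤ 1 ∧
        v = popLoss γ P w} := by
      refine ⟨0, ?_⟩
      rintro _ ⟨w, -, rfl⟩
      exact popLoss_nonneg hγ0 w
    refine (csInf_le hbdd ⟨w₀, hw₀.le, rfl⟩).trans (popLoss_le_of_ae_le hγ0 ?_)
    have hm : MeasurableSet {p : EuclideanSpace ℝ (Fin d) × ℝ | γ ≤ ⟪w₀, p.1⟫ * p.2} :=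
      (isClosed_le (by fun_prop) (by fun_prop)).measurableSet
    filter_upwards [(mem_ae_iff_prob_eq_one hm).2 hmargin,
      ae_abs_margin_le_one hsupp hw₀.le] with p hp hp1
    exact phiLoss_le_of_margin hγ0 hp (abs_le.1 hp1).2
  refine ⟨hInf, fun W _ hW hle => ?_⟩
  have hball : ∀ᵐ w ∂W, ‖w‖ ≤ 1 :=
    (mem_ae_iff_prob_eq_one
      (isClosed_le (by fun_prop) (by fun_prop) : IsClosed {w : EuclideanSpace ℝ (Fin d) |
        ‖w‖ ≤ 1}).measurableSet).2 hW
  have hint : Integrable (popLoss γ P) W := by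
    refine Integrable.of_bound stronglyMeasurable_popLoss.aestronglyMeasurable (3 / 2 + 2 / γ) ?_
    filter_upwards [hball] with w hw
    rw [Real.norm_of_nonneg (popLoss_nonneg hγ0 w)]
    exact popLoss_le_of_ae_le hγ0
      ((ae_abs_margin_le_one hsupp hw).mono fun p hp => phiLoss_le hγ0 hp)
  have hmono : ∫ w, clsErr P w ∂W ≤ ∫ w, 8 / 9 * popLoss γ P w ∂W :=
    integral_mono_of_nonneg (.of_forall fun _ => ENNReal.toReal_nonneg) (hint.const_mul _)
      (hball.mono fun w hw => clsErr_le_popLoss hγ0 hsupp hw)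
  rw [integral_const_mul] at hmono
  linarith
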